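/- Let K be a field and suppose there exists at least one solv-henselian valuation ring of K whose residue field is not solv-closed. Then the intersection of all solv-henselian valuation rings of K whose residue field is not solv-closed is itself a solv-henselian valuation ring of K. -/

import Mathlib

noncomputable section

/-- The maximal solvable extension of `K` inside an ambient field extension `Ω`:
the compositum of all finite Galois subextensions of `Ω/K` with solvable Galois group. -/
def maxSolvableExt (K Ω : Type*) [Field K] [Field Ω] [Algebra K Ω] :
    IntermediateField K Ω :=
  ⨆ L : {L : IntermediateField K Ω //
      FiniteDimensional K ↥L ∧ IsGalois K ↥L ∧ IsSolvable (↥L ≃ₐ[K] ↥L)}, L.1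

/-- `K^solv`, the maximal solvable extension of `K` (inside a fixed algebraic closure). -/
abbrev solvClosure (K : Type*) [Field K] : IntermediateField K (AlgebraicClosure K) :=
  maxSolvableExt K (AlgebraicClosure K)

/-- A valuation (subring) of `K` is solv-henselian if it extends uniquely to `K^solv`. -/
def IsSolvHenselian {K : Type*} [Field K] (O : ValuationSubring K) : Prop :=
  ∃! O' : ValuationSubring ↥(solvClosure K),
    O'.comap (algebraMap K ↥(solvClosure K)) = O

/-- A field is solv-closed if it admits no nontrivial finite Galois extension with
solvable Galois group. -/
def IsSolvClosed (K : Type*) [Field K] : Prop :=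
  ∀ L : IntermediateField K (AlgebraicClosure K),
    FiniteDimensional K ↥L → IsGalois K ↥L → IsSolvable (↥L ≃ₐ[K] ↥L) → L = ⊥

section OrbitProduct

open Finset Polynomial

/-- The monic polynomial function whose roots are the orbit of `0` under `x ↦ ζ * x + 1`. When
`1 + ζ + ⋯ + ζ ^ (p - 1) = 0` it is the Artin–Schreier polynomial if `ζ = 1`, and it is linearly
equivalent to a Kummer polynomial otherwise. -/
def orbitProd {R : Type*} [CommRing R] (p : ℕ) (ζ x : R) : R :=
  ∏ i ∈ range p, (x - ∑ j ∈ range i, ζ ^ j)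

theorem map_orbitProd {R S : Type*} [CommRing R] [CommRing S] (f : R →+* S) (p : ℕ) (ζ x : R) :
    f (orbitProd p ζ x) = orbitProd p (f ζ) (f x) := by
  simp [orbitProd, map_prod, map_sum]

theorem orbitProd_mul_add_one {R : Type*} [CommRing R] {p : ℕ} {ζ : R}
    (hζ : ∑ j ∈ range p, ζ ^ j = 0) (x : R) :
    orbitProd p ζ (ζ * x + 1) = orbitProd p ζ x := by
  have hp : ζ ^ p = 1 := by
    have := geom_sum_mul ζ p
    rw [hζ, zero_mul] at this
    exact (sub_eq_zero.mp this.symm)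
  rcases p with _ | q
  · simp [orbitProd]
  have h1 : ∏ i ∈ range (q + 1), (ζ * x + 1 - ∑ j ∈ range (i + 1), ζ ^ j) =
      orbitProd (q + 1) ζ x := by
    have : ∀ i ∈ range (q + 1), (ζ * x + 1 - ∑ j ∈ range (i + 1), ζ ^ j) =
        ζ * (x - ∑ j ∈ range i, ζ ^ j) := by
      intro i _
      rw [geom_sum_succ]; ring
    rw [prod_congr rfl this, prod_mul_distrib, prod_const, card_range, hp, one_mul, orbitProd]
  rw [← h1, orbitProd, prod_range_succ', prod_range_succ, hζ]
  simp

theorem orbitProd_pow_mul_add {R : Type*} [CommRing R] {p : ℕ} {ζ : R}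
    (hζ : ∑ j ∈ range p, ζ ^ j = 0) (x : R) (i : ℕ) :
    orbitProd p ζ (ζ ^ i * x + ∑ j ∈ range i, ζ ^ j) = orbitProd p ζ x := by
  induction i with
  | zero => simp
  | succ i ih =>
    rw [← ih, ← orbitProd_mul_add_one hζ (ζ ^ i * x + _), geom_sum_succ]
    ring_nf

variable {F : Type*} [Field F] {p : ℕ} {ζ : F}

theorem pow_eq_one_of_geom_sum_eq_zero (hζ : ∑ j ∈ range p, ζ ^ j = 0) : ζ ^ p = 1 := by
  have := geom_sum_mul ζ p
  rw [hζ, zero_mul] at this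
  exact (sub_eq_zero.mp this.symm)

theorem ne_zero_of_geom_sum_eq_zero (hp : p.Prime) (hζ : ∑ j ∈ range p, ζ ^ j = 0) : ζ ≠ 0 := by
  rintro rfl
  have := pow_eq_one_of_geom_sum_eq_zero hζ
  simp [hp.ne_zero] at this

theorem geom_sum_ne_zero_of_lt (hp : p.Prime) (hζ : ∑ j ∈ range p, ζ ^ j = 0) {j : ℕ}
    (h0 : 0 < j) (hj : j < p) : ∑ i ∈ range j, ζ ^ i ≠ 0 := by
  intro h
  have hcop : Nat.Coprime j p :=
    (hp.coprime_iff_not_dvd.mpr (Nat.not_dvd_of_pos_of_lt h0 hj)).symm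
  have h1 : ζ = 1 := by
    have := pow_gcd_eq_one.mpr
      ⟨pow_eq_one_of_geom_sum_eq_zero h, pow_eq_one_of_geom_sum_eq_zero hζ⟩
    rwa [hcop, pow_one] at this
  subst h1
  simp only [one_pow, sum_const, card_range, nsmul_eq_mul, mul_one] at h hζ
  have := (Nat.isCoprime_iff_coprime.mpr hcop)
  obtain ⟨a, b, hab⟩ := this
  have := congrArg (Int.cast : ℤ → F) hab
  push_cast at this
  rw [h, hζ] at this
  simp at this

theorem pow_mul_add_geom_sum_injOn (hp : p.Prime) (hζ : ∑ j ∈ range p, ζ ^ j = 0) {y : F}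
    (hy : ζ * y + 1 ≠ y) :
    Set.InjOn (fun i : ℕ ↦ ζ ^ i * y + ∑ j ∈ range i, ζ ^ j) (range p : Set ℕ) := by
  have key : ∀ a b : ℕ, a < b → b < p →
      ζ ^ a * y + ∑ j ∈ range a, ζ ^ j ≠ ζ ^ b * y + ∑ j ∈ range b, ζ ^ j := by
    intro a b hab hb h
    obtain ⟨m, rfl⟩ := Nat.exists_eq_add_of_lt hab
    have hz := pow_ne_zero a (ne_zero_of_geom_sum_eq_zero hp hζ)
    have hc := geom_sum_ne_zero_of_lt hp hζ (j := m + 1) (by omega) (by omega)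
    rw [add_assoc, sum_range_add] at h
    simp only [pow_add ζ a, ← mul_sum] at h
    have hg := geom_sum_mul ζ (m + 1)
    have : ζ ^ a * ((∑ j ∈ range (m + 1), ζ ^ j) * (ζ * y + 1 - y)) = 0 := by
      linear_combination -h + ζ ^ a * y * hg
    simp [hz, hc, sub_eq_zero, hy] at this
  intro a ha b hb h
  simp only [coe_range, Set.mem_Iio] at ha hb
  rcases lt_trichotomy a b with hab | hab | hab
  · exact (key a b hab hb h).elim
  · exact hab
  · exact (key b a hab ha h.symm).elim

theorem prod_X_sub_C_sub_C_orbitProd (hp : p.Prime) (hζ : ∑ j ∈ range p, ζ ^ j = 0) {y : F}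
    (hy : ζ * y + 1 ≠ y) :
    ∏ i ∈ range p, (X - C (∑ j ∈ range i, ζ ^ j)) - C (orbitProd p ζ y) =
      ∏ i ∈ range p, (X - C (ζ ^ i * y + ∑ j ∈ range i, ζ ^ j)) := by
  have hinj := pow_mul_add_geom_sum_injOn hp hζ hy
  classical
  refine eq_of_degree_sub_lt_of_eval_finset_eq
    ((range p).image (fun i : ℕ ↦ ζ ^ i * y + ∑ j ∈ range i, ζ ^ j)) ?_ ?_
  · rw [card_image_of_injOn hinj, card_range, sub_right_comm]
    have hd1 : (∏ i ∈ range p, (X - C (∑ j ∈ range i, ζ ^ j))).degree = (p : WithBot ℕ) := by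
      simp only [degree_prod, degree_X_sub_C, sum_const, card_range, nsmul_eq_mul, mul_one]
    have hd2 : (∏ i ∈ range p, (X - C (ζ ^ i * y + ∑ j ∈ range i, ζ ^ j))).degree = (p : WithBot ℕ) := by
      simp only [degree_prod, degree_X_sub_C, sum_const, card_range, nsmul_eq_mul, mul_one]
    have hp0 : (0 : WithBot ℕ) < p := by exact_mod_cast hp.pos
    refine (degree_sub_le _ _).trans_lt (max_lt ?_ (degree_C_le.trans_lt hp0))
    rw [← hd1]
    refine degree_sub_lt_left (hd1.trans hd2.symm) ?_ ?_
    · exact (monic_prod_of_monic _ _ fun i _ ↦ monic_X_sub_C _).ne_zero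
    · rw [(monic_prod_of_monic _ _ fun i _ ↦ monic_X_sub_C _).leadingCoeff,
        (monic_prod_of_monic _ _ fun i _ ↦ monic_X_sub_C _).leadingCoeff]
  · intro x hx
    obtain ⟨i, hi, rfl⟩ := mem_image.mp hx
    have h0 := orbitProd_pow_mul_add hζ y i
    rw [orbitProd] at h0
    simp only [eval_sub, eval_prod, eval_X, eval_C, h0, sub_self]
    exact (prod_eq_zero hi (sub_self _)).symm

theorem exists_eq_of_orbitProd_eq (hp : p.Prime) (hζ : ∑ j ∈ range p, ζ ^ j = 0) {x y : F}
    (hy : ζ * y + 1 ≠ y) (h : orbitProd p ζ x = orbitProd p ζ y) :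
    ∃ i < p, x = ζ ^ i * y + ∑ j ∈ range i, ζ ^ j := by
  have := congrArg (eval x) (prod_X_sub_C_sub_C_orbitProd hp hζ hy)
  simp only [eval_sub, eval_prod, eval_X, eval_C] at this
  rw [← h, orbitProd, sub_self, eq_comm, prod_eq_zero_iff] at this
  obtain ⟨i, hi, h⟩ := this
  exact ⟨i, mem_range.mp hi, sub_eq_zero.mp h⟩

end OrbitProduct

section MaxSolvableExt

open Finset Polynomial IntermediateField

variable {K Ω : Type*} [Field K] [Field Ω] [Algebra K Ω]

instance normal_maxSolvableExt : Normal K (maxSolvableExt K Ω) := by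
  have : ∀ L : {L : IntermediateField K Ω //
      FiniteDimensional K L ∧ IsGalois K L ∧ IsSolvable (L ≃ₐ[K] L)}, Normal K L.1 :=
    fun L ↦ L.2.2.1.to_normal
  exact normal_iSup _ _ _

instance isSeparable_maxSolvableExt : Algebra.IsSeparable K (maxSolvableExt K Ω) := by
  have : ∀ L : {L : IntermediateField K Ω //
      FiniteDimensional K L ∧ IsGalois K L ∧ IsSolvable (L ≃ₐ[K] L)}, Algebra.IsSeparable K L.1 :=
    fun L ↦ L.2.2.1.to_isSeparable
  exact isSeparable_iSup K Ω

instance isGalois_maxSolvableExt : IsGalois K (maxSolvableExt K Ω) where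

/-- The elements fixed by some term of the derived series of the automorphism group. -/
def derivedFixedField (K Ω : Type*) [Field K] [Field Ω] [Algebra K Ω] :
    IntermediateField K Ω where
  carrier := {x | ∃ n, ∀ σ ∈ derivedSeries (Ω ≃ₐ[K] Ω) n, σ x = x}
  mul_mem' := by
    rintro a b ⟨n, hn⟩ ⟨m, hm⟩
    refine ⟨max n m, fun σ hσ ↦ ?_⟩
    rw [map_mul, hn σ (derivedSeries_antitone _ (le_max_left n m) hσ),
      hm σ (derivedSeries_antitone _ (le_max_right n m) hσ)]
  add_mem' := by
    rintro a b ⟨n, hn⟩ ⟨m, hm⟩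
    refine ⟨max n m, fun σ hσ ↦ ?_⟩
    rw [map_add, hn σ (derivedSeries_antitone _ (le_max_left n m) hσ),
      hm σ (derivedSeries_antitone _ (le_max_right n m) hσ)]
  algebraMap_mem' r := ⟨0, fun σ _ ↦ σ.commutes r⟩
  inv_mem' := by
    rintro a ⟨n, hn⟩
    exact ⟨n, fun σ hσ ↦ by rw [map_inv₀, hn σ hσ]⟩

theorem mem_derivedFixedField {x : Ω} :
    x ∈ derivedFixedField K Ω ↔ ∃ n, ∀ σ ∈ derivedSeries (Ω ≃ₐ[K] Ω) n, σ x = x :=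
  Iff.rfl

theorem maxSolvableExt_le_derivedFixedField [Normal K Ω] :
    maxSolvableExt K Ω ≤ derivedFixedField K Ω := by
  refine iSup_le ?_
  rintro ⟨L, hfin, hgal, ⟨n, hn⟩⟩ x hx
  refine ⟨n, fun σ hσ ↦ ?_⟩
  have h := Subgroup.mem_map_of_mem (AlgEquiv.restrictNormalHom L) hσ
  rw [map_derivedSeries_eq (AlgEquiv.restrictNormalHom_surjective (F := K) (K₁ := L) Ω), hn,
    Subgroup.mem_bot] at h
  have := AlgEquiv.restrictNormal_commutes σ L ⟨x, hx⟩
  change algebraMap L Ω ((AlgEquiv.restrictNormalHom L σ) _) = σ x at this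
  rw [h] at this
  exact this.symm

theorem mem_maxSolvableExt_of_isSeparable [Normal K Ω] {x : Ω} (hx : IsSeparable K x)
    (hfix : x ∈ derivedFixedField K Ω) : x ∈ maxSolvableExt K Ω := by
  obtain ⟨n, hn⟩ := hfix
  let E : IntermediateField K Ω := normalClosure K K⟮x⟯ Ω
  have hint : IsIntegral K x := hx.isIntegral
  have : FiniteDimensional K K⟮x⟯ := adjoin.finiteDimensional hint
  have : Algebra.IsSeparable K K⟮x⟯ := (isSeparable_adjoin_simple_iff_isSeparable K Ω).mpr hx
  have hEsep : Algebra.IsSeparable K E := by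
    rw [show E = _ from normalClosure_def'' K⟮x⟯]
    have := fun f : Ω ≃ₐ[K] Ω ↦ Algebra.IsSeparable.of_algHom K K⟮x⟯
      (equivMap K⟮x⟯ (f : Ω →ₐ[K] Ω)).symm.toAlgHom
    exact isSeparable_iSup K Ω
  have hE : IsGalois K E := { to_normal := inferInstanceAs (Normal K (normalClosure K K⟮x⟯ Ω)) }
  have hxE : x ∈ E := le_normalClosure K⟮x⟯ (mem_adjoin_simple_self K x)
  have hsol : Group.IsSolvable (E ≃ₐ[K] E) := by
    refine ⟨n, ?_⟩
    rw [← map_derivedSeries_eq (AlgEquiv.restrictNormalHom_surjective (F := K) (K₁ := E) Ω),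
      Subgroup.map_eq_bot_iff]
    intro σ hσ
    rw [MonoidHom.mem_ker]
    have hle : E ≤ fixedField (derivedSeries (Ω ≃ₐ[K] Ω) n) := by
      rw [show E = _ from normalClosure_def'' K⟮x⟯]
      refine iSup_le fun f ↦ ?_
      rw [adjoin_map, Set.image_singleton, adjoin_simple_le_iff]
      rintro ⟨τ, hτ⟩
      have := hn _ ((derivedSeries_normal (Ω ≃ₐ[K] Ω) n).conj_mem τ hτ f⁻¹)
      rw [inv_inv, AlgEquiv.mul_apply, AlgEquiv.mul_apply] at this
      have := congrArg f this
      rwa [← AlgEquiv.mul_apply f f⁻¹, mul_inv_cancel, AlgEquiv.one_apply] at this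
    ext e
    rw [AlgEquiv.restrictNormalHom_apply]
    exact hle e.2 ⟨σ, hσ⟩
  exact le_iSup (fun L : {L : IntermediateField K Ω //
      FiniteDimensional K L ∧ IsGalois K L ∧ IsSolvable (L ≃ₐ[K] L)} ↦ L.1)
      ⟨E, inferInstance, hE, hsol⟩ hxE

theorem mem_derivedFixedField_of_commute {x : Ω} {n : ℕ}
    (h : ∀ σ ∈ derivedSeries (Ω ≃ₐ[K] Ω) n, ∀ τ ∈ derivedSeries (Ω ≃ₐ[K] Ω) n,
      σ (τ x) = τ (σ x)) : x ∈ derivedFixedField K Ω := by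
  refine ⟨n + 1, fun ρ hρ ↦ ?_⟩
  have hle : derivedSeries (Ω ≃ₐ[K] Ω) (n + 1) ≤ MulAction.stabilizer (Ω ≃ₐ[K] Ω) x := by
    rw [derivedSeries_succ, Subgroup.commutator_le]
    intro σ hσ τ hτ
    rw [MulAction.mem_stabilizer_iff, commutatorElement_def, AlgEquiv.smul_def]
    simp only [AlgEquiv.mul_apply]
    rw [h _ (inv_mem hσ) _ (inv_mem hτ)]
    simp only [← AlgEquiv.mul_apply]
    simp
  exact hle hρ

theorem geom_sum_root_mem {p : ℕ} (hp : p.Prime) [Normal K Ω] {ζ : Ω}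
    (hζ : ∑ j ∈ range p, ζ ^ j = 0) : ζ ∈ maxSolvableExt K Ω := by
  have h1 := pow_eq_one_of_geom_sum_eq_zero hζ
  by_cases hz1 : ζ = 1
  · rw [hz1]; exact one_mem _
  have hprim : IsPrimitiveRoot ζ p := by
    have := Fact.mk hp
    exact IsPrimitiveRoot.iff_orderOf.mpr (orderOf_eq_prime h1 hz1)
  refine mem_maxSolvableExt_of_isSeparable ?_ (mem_derivedFixedField_of_commute (n := 0) ?_)
  · have := NeZero.mk hp.ne_zero
    have hpΩ := hprim.neZero'.out
    have hpK : (p : K) ≠ 0 := fun h0 ↦ hpΩ (by rw [← map_natCast (algebraMap K Ω), h0, map_zero])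
    exact (X_pow_sub_one_separable_iff.mpr hpK).of_dvd (minpoly.dvd _ _ (by simp [h1]))
  · have key : ∀ σ : Ω ≃ₐ[K] Ω, ∃ i : ℕ, σ ζ = ζ ^ i := fun σ ↦ by
      have := NeZero.mk hp.ne_zero
      obtain ⟨i, -, hi⟩ := hprim.eq_pow_of_pow_eq_one (ξ := σ ζ) (by rw [← map_pow, h1, map_one])
      exact ⟨i, hi.symm⟩
    intro σ _ τ _
    obtain ⟨i, hi⟩ := key σ
    obtain ⟨j, hj⟩ := key τ
    rw [hj, hi, map_pow, map_pow, hi, hj, ← pow_mul, ← pow_mul, mul_comm]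

theorem orbitProd_root_mem {p : ℕ} (hp : p.Prime) [Normal K Ω] {ζ : Ω}
    (hζ : ∑ j ∈ range p, ζ ^ j = 0) {y : Ω} (hy : orbitProd p ζ y ∈ maxSolvableExt K Ω) :
    y ∈ maxSolvableExt K Ω := by
  have hζL := geom_sum_root_mem (K := K) hp hζ
  by_cases hfix : ζ * y + 1 = y
  · have h1 : (1 - ζ) * y = 1 := by linear_combination -hfix
    rw [eq_inv_of_mul_eq_one_right h1]
    exact inv_mem (sub_mem (one_mem _) hζL)
  refine mem_maxSolvableExt_of_isSeparable ?_ ?_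
  · refine IsSeparable.of_algebra_isSeparable_of_isSeparable (E := maxSolvableExt K Ω) K ?_
    let ζ' : maxSolvableExt K Ω := ⟨ζ, hζL⟩
    let a' : maxSolvableExt K Ω := ⟨_, hy⟩
    let q := ∏ i ∈ range p, (X - C (∑ j ∈ range i, ζ' ^ j)) - C a'
    have hq : q.map (algebraMap (maxSolvableExt K Ω) Ω) =
        ∏ i ∈ range p, (X - C (ζ ^ i * y + ∑ j ∈ range i, ζ ^ j)) := by
      rw [← prod_X_sub_C_sub_C_orbitProd hp hζ hfix]
      simp only [q, Polynomial.map_sub, Polynomial.map_prod, Polynomial.map_X, Polynomial.map_C]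
      simp only [map_sum, map_pow]
      rfl
    have hsep : q.Separable := by
      rw [← separable_map (algebraMap (maxSolvableExt K Ω) Ω), hq]
      exact separable_prod_X_sub_C_iff'.mpr (pow_mul_add_geom_sum_injOn hp hζ hfix)
    refine hsep.of_dvd (minpoly.dvd _ _ ?_)
    rw [aeval_def, ← eval_map, hq, eval_prod]
    exact prod_eq_zero (mem_range.mpr hp.pos) (by simp)
  obtain ⟨n, hn⟩ := maxSolvableExt_le_derivedFixedField hζL
  obtain ⟨m, hm⟩ := maxSolvableExt_le_derivedFixedField hy
  have key : ∀ σ ∈ derivedSeries (Ω ≃ₐ[K] Ω) (max n m), σ ζ = ζ ∧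
      ∃ i : ℕ, σ y = ζ ^ i * y + ∑ j ∈ range i, ζ ^ j := by
    intro σ hσ
    have h1 := hn σ (derivedSeries_antitone _ (le_max_left n m) hσ)
    have h2 := hm σ (derivedSeries_antitone _ (le_max_right n m) hσ)
    have h3 := map_orbitProd (σ : Ω →+* Ω) p ζ y
    simp only [RingHom.coe_coe] at h3
    rw [h2, h1] at h3
    obtain ⟨i, -, hi⟩ := exists_eq_of_orbitProd_eq hp hζ hfix h3.symm
    exact ⟨h1, i, hi⟩
  refine mem_derivedFixedField_of_commute (n := max n m) fun σ hσ τ hτ ↦ ?_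
  obtain ⟨hσζ, i, hi⟩ := key σ hσ
  obtain ⟨hτζ, j, hj⟩ := key τ hτ
  simp only [hi, hj, map_add, map_mul, map_sum, map_pow, hσζ, hτζ]
  have h1 := geom_sum_mul ζ i
  have h2 := geom_sum_mul ζ j
  linear_combination (∑ k ∈ range j, ζ ^ k) * h1 - (∑ k ∈ range i, ζ ^ k) * h2

end MaxSolvableExt

section UniqueExtension

open Polynomial

variable {K L : Type*} [Field K] [Field L] [Algebra K L]

theorem isIntegral_iff_coeff_minpoly_mem [Algebra.IsIntegral K L] (O : ValuationSubring K)
    (x : L) : IsIntegral O x ↔ ∀ i, (minpoly K x).coeff i ∈ O := by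
  constructor
  · intro h i
    have := minpoly.isIntegrallyClosed_eq_field_fractions K L h
    rw [Algebra.algebraMap_self_apply] at this
    rw [this, coeff_map]
    exact ((minpoly O x).coeff i).2
  · intro h
    have hl : minpoly K x ∈ lifts (algebraMap O K) :=
      (lifts_iff_coeff_lifts _).mpr fun i ↦ ⟨⟨_, h i⟩, rfl⟩
    obtain ⟨q, hq, -, hm⟩ := lifts_and_natDegree_eq_and_monic hl
      (minpoly.monic (Algebra.IsIntegral.isIntegral x))
    refine ⟨q, hm, ?_⟩
    rw [IsScalarTower.algebraMap_eq O K L, ← eval₂_map, hq]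
    exact minpoly.aeval K x

/-- The conjugates of an integral element are integral. -/
theorem isIntegral_conj {O : ValuationSubring K} {x : L} (hx : IsIntegral O x)
    (σ : L ≃ₐ[K] L) : IsIntegral O (σ x) :=
  hx.map (σ.toAlgHom.restrictScalars O)

theorem isIntegral_of_mem_of_invariant [Normal K L] {O : ValuationSubring K}
    {C : ValuationSubring L} (hC : C.comap (algebraMap K L) = O)
    (hinv : ∀ (σ : L ≃ₐ[K] L), ∀ x ∈ C, σ x ∈ C) {x : L} (hx : x ∈ C) : IsIntegral O x := by
  rw [isIntegral_iff_coeff_minpoly_mem]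
  intro i
  rw [← hC, ValuationSubring.mem_comap, ← coeff_map]
  have hl : (minpoly K x).map (algebraMap K L) ∈ lifts C.subtype := by
    have hs : ((minpoly K x).map (algebraMap K L)).Splits := Normal.splits inferInstance x
    rw [hs.eq_prod_roots_of_monic ((minpoly.monic (Algebra.IsIntegral.isIntegral x)).map _)]
    refine multiset_prod_mem _ fun q hq ↦ ?_
    obtain ⟨r, hr, rfl⟩ := Multiset.mem_map.mp hq
    have hr0 : aeval r (minpoly K x) = 0 := by
      rw [aeval_def, ← eval_map]
      exact (mem_roots'.mp hr).2
    obtain ⟨σ, rfl⟩ := minpoly.exists_algEquiv_of_root' (Algebra.IsAlgebraic.isAlgebraic x) hr0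
    refine (mem_lifts _).mpr ⟨X - Polynomial.C ⟨_, hinv σ x hx⟩, ?_⟩
    rw [Polynomial.map_sub, map_X, map_C]
    rfl
  obtain ⟨c, hc⟩ := (lifts_iff_coeff_lifts _).mp hl i
  rw [← hc]
  exact c.2

/-- The integral closure of a valuation ring, when it is a valuation ring. -/
def integralClosureValuationSubring {O : ValuationSubring K}
    (h : ∀ x : L, IsIntegral O x ∨ IsIntegral O x⁻¹) :
    ValuationSubring L :=
  { (integralClosure O L).toSubring with mem_or_inv_mem' := h }

theorem isIntegral_algebraMap_iff_mem {O : ValuationSubring K} {x : K} :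
    IsIntegral O (algebraMap K L x) ↔ x ∈ O := by
  rw [isIntegral_algebraMap_iff (algebraMap K L).injective, IsIntegrallyClosed.isIntegral_iff]
  exact ⟨by rintro ⟨y, rfl⟩; exact y.2, fun hk ↦ ⟨⟨x, hk⟩, rfl⟩⟩

/-- A valuation ring extends uniquely to a normal extension if and only if its integral closure
there is a valuation ring. -/
theorem existsUnique_comap_eq_iff [Normal K L] (O : ValuationSubring K) :
    (∃! C : ValuationSubring L, C.comap (algebraMap K L) = O) ↔
      ∀ x : L, IsIntegral O x ∨ IsIntegral O x⁻¹ := by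
  constructor
  · rintro ⟨C, hC, huniq⟩ x
    have hinv : ∀ (σ : L ≃ₐ[K] L), ∀ x ∈ C, σ x ∈ C := by
      intro σ x hx
      have : C.comap (σ : L →+* L) = C := huniq _ <| by
        ext k
        rw [← hC]
        simp [ValuationSubring.mem_comap]
      rw [← this] at hx
      exact hx
    exact (C.mem_or_inv_mem x).imp (isIntegral_of_mem_of_invariant hC hinv)
      (isIntegral_of_mem_of_invariant hC hinv)
  · intro h
    refine ⟨integralClosureValuationSubring h, ?_, ?_⟩
    · ext k
      exact isIntegral_algebraMap_iff_mem
    · intro C hC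
      have hOC : ∀ k : K, k ∈ O ↔ algebraMap K L k ∈ C := fun k ↦ by
        rw [← hC, ValuationSubring.mem_comap]
      have hBC : ∀ x, IsIntegral O x → x ∈ C := by
        intro x hx
        let φ : O →+* C :=
          ((algebraMap K L).comp O.subtype).codRestrict C fun k ↦ (hOC k).mp k.2
        obtain ⟨y, rfl⟩ := IsIntegrallyClosed.isIntegral_iff.mp
          (hx.map_of_comp_eq φ (RingHom.id L) rfl : IsIntegral C x)
        exact y.2
      refine le_antisymm (fun x hx ↦ ?_) hBC
      change IsIntegral O x
      by_contra hnx
      have hz : IsIntegral O x⁻¹ := (h x).resolve_left hnx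
      let f : integralClosure O L →+* C :=
        (integralClosure O L).val.toRingHom.codRestrict C fun b ↦ hBC b b.2
      let I : Ideal (integralClosure O L) := (IsLocalRing.maximalIdeal C).comap f
      have hI : I.IsMaximal := by
        refine Ideal.isMaximal_of_isIntegral_of_isMaximal_comap (R := O) I ?_
        convert IsLocalRing.maximalIdeal.isMaximal O
        ext o
        rw [Ideal.mem_comap, Ideal.mem_comap, ← ValuationSubring.coe_mem_nonunits_iff,
          ← ValuationSubring.coe_mem_nonunits_iff, ValuationSubring.mem_nonunits_iff_or,
          ValuationSubring.mem_nonunits_iff_or, hOC, map_inv₀]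
        change algebraMap K L o = 0 ∨ _ ↔ _
        rw [map_eq_zero_iff _ (algebraMap K L).injective]
        rfl
      have hx0 : x ≠ 0 := by
        rintro rfl
        exact hnx isIntegral_zero
      have hzI : (⟨x⁻¹, hz⟩ : integralClosure O L) ∉ I := by
        rw [Ideal.mem_comap, ← ValuationSubring.coe_mem_nonunits_iff]
        change x⁻¹ ∉ C.nonunits
        rw [ValuationSubring.inv_mem_nonunits_iff]
        simp [hx0, hx]
      obtain ⟨b, i, hi, hb⟩ := hI.exists_inv hzI
      have hb' : (b : L) * x⁻¹ + i = 1 := congrArg Subtype.val hb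
      rcases h (i * x) with hw | hw
      · refine hnx ?_
        have : x = b + i * x := by
          field_simp at hb'
          linear_combination -hb'
        rw [this]
        exact b.2.add hw
      · have hi0 : (i : L) ≠ 0 := by
          intro hi0
          rw [hi0, add_zero] at hb'
          refine hnx ?_
          rw [← eq_mul_inv_iff_mul_eq₀ (inv_ne_zero hx0), inv_inv, one_mul] at hb'
          exact hb' ▸ b.2
        refine hzI ?_
        have : (⟨x⁻¹, hz⟩ : integralClosure O L) = ⟨_, hw⟩ * i := by
          apply Subtype.ext
          change x⁻¹ = (i * x)⁻¹ * i
          field_simp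
        rw [this]
        exact I.mul_mem_left _ hi

end UniqueExtension

section Approximation

open Finset

/-- Chinese remaindering for two incomparable valuation rings. -/
theorem exists_valuation_sub_lt_one {M : Type*} [Field M] {A₁ A₂ : ValuationSubring M}
    (h₁₂ : ¬ A₁ ≤ A₂) (h₂₁ : ¬ A₂ ≤ A₁) {u : M} (hu : u ∈ A₁) :
    ∃ a, A₁.valuation (a - u) < 1 ∧ A₂.valuation a < 1 := by
  obtain ⟨s, hs₁, hs₂⟩ := SetLike.not_le_iff_exists.mp h₁₂
  obtain ⟨t, ht₂, ht₁⟩ := SetLike.not_le_iff_exists.mp h₂₁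
  simp only [← ValuationSubring.valuation_le_one_iff, not_le] at hs₁ hs₂ ht₁ ht₂ hu
  have hs0 : s ≠ 0 := by rintro rfl; simp at hs₂
  have ht0 : t ≠ 0 := by rintro rfl; simp at ht₁
  obtain ⟨z, hz0, hz₁, hz₂⟩ : ∃ z : M, z ≠ 0 ∧ A₁.valuation z < 1 ∧ 1 < A₂.valuation z := by
    refine ⟨s * t⁻¹, mul_ne_zero hs0 (inv_ne_zero ht0), ?_, ?_⟩
    · rw [map_mul, map_inv₀]
      exact (mul_le_of_le_one_left' hs₁).trans_lt (inv_lt_one_of_one_lt₀ ht₁)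
    · rw [map_mul, map_inv₀]
      refine hs₂.trans_le (le_mul_of_one_le_right' ?_)
      exact (one_le_inv₀ (by simpa [zero_lt_iff] using ht0)).mpr ht₂
  by_cases hu₂ : A₂.valuation u ≤ 1
  · have h1 : A₁.valuation (1 + z) = 1 := Valuation.map_one_add_of_lt _ hz₁
    have h2 : A₂.valuation (1 + z) = A₂.valuation z :=
      Valuation.map_add_eq_of_lt_right _ (by rwa [map_one])
    have hne : 1 + z ≠ 0 := by
      intro h0
      simp [h0] at h1
    refine ⟨u / (1 + z), ?_, ?_⟩
    · rw [show u / (1 + z) - u = - (u * z) / (1 + z) by field_simp; ring, map_div₀, h1, div_one,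
        Valuation.map_neg, map_mul]
      exact (mul_le_of_le_one_left' hu).trans_lt hz₁
    · rw [map_div₀, h2]
      exact (div_lt_one₀ (zero_lt_one.trans hz₂)).mpr (hu₂.trans_lt hz₂)
  by_cases hu₁ : A₁.valuation u < 1
  · exact ⟨0, by simpa using hu₁, by simp⟩
  have hu1 : A₁.valuation u = 1 := le_antisymm hu (not_lt.mp hu₁)
  have hu0 : u ≠ 0 := by rintro rfl; simp at hu1
  rw [not_le] at hu₂
  have h1 : A₁.valuation (u⁻¹ + z) = 1 := by
    rw [Valuation.map_add_eq_of_lt_left _ (by simpa [hu1] using hz₁)]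
    simp [hu1]
  have h2 : A₂.valuation (u⁻¹ + z) = A₂.valuation z := by
    refine Valuation.map_add_eq_of_lt_right _ ?_
    rw [map_inv₀]
    exact (inv_lt_one_of_one_lt₀ hu₂).trans hz₂
  have hne : u⁻¹ + z ≠ 0 := by
    intro h0
    simp [h0] at h1
  refine ⟨(u⁻¹ + z)⁻¹, ?_, ?_⟩
  · have : (u⁻¹ + z)⁻¹ - u = - (u * z) / (u⁻¹ + z) := by
      rw [eq_div_iff hne, sub_mul, inv_mul_cancel₀ hne, mul_add, mul_inv_cancel₀ hu0]
      ring
    rw [this, map_div₀, h1, div_one, Valuation.map_neg, map_mul, hu1, one_mul]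
    exact hz₁
  · rw [map_inv₀, h2]
    exact inv_lt_one_of_one_lt₀ hz₂

theorem valuation_eq_one_of_geom_sum_eq_zero {L : Type*} [Field L] (B : ValuationSubring L)
    {p : ℕ} (hp : p.Prime) {ζ : L} (hζ : ∑ j ∈ range p, ζ ^ j = 0) : B.valuation ζ = 1 := by
  have h := congrArg B.valuation (pow_eq_one_of_geom_sum_eq_zero hζ)
  rw [map_pow, map_one] at h
  exact (pow_eq_one_iff_of_nonneg zero_le hp.ne_zero).mp h

theorem one_le_valuation_geom_sum {L : Type*} [Field L] (B : ValuationSubring L) {p : ℕ}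
    (hp : p.Prime) {ζ : L} (hζ : ∑ j ∈ range p, ζ ^ j = 0) {j : ℕ} (h0 : 0 < j) (hj : j < p) :
    1 ≤ B.valuation (∑ i ∈ range j, ζ ^ i) := by
  have hζB : ζ ∈ B :=
    (B.valuation_le_one_iff ζ).mp (valuation_eq_one_of_geom_sum_eq_zero B hp hζ).le
  let ζ' : B := ⟨ζ, hζB⟩
  have hζ' : ∑ j ∈ range p, ζ' ^ j = 0 := Subtype.ext (by simpa [ζ'] using hζ)
  have hres : ∑ j ∈ range p, (IsLocalRing.residue B ζ') ^ j = 0 := by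
    simp only [← map_pow, ← map_sum, hζ', map_zero]
  have := geom_sum_ne_zero_of_lt hp hres h0 hj
  simp only [← map_pow, ← map_sum] at this
  rw [Ne, IsLocalRing.residue_eq_zero_iff, ValuationSubring.valuation_lt_one_iff, not_lt] at this
  simpa [ζ'] using this

/-- A Hensel lemma for the polynomials `orbitProd p ζ X - a`. -/
theorem exists_orbitProd_eq_of_invariant {M L : Type*} [Field M] [Field L] [Algebra M L]
    [IsGalois M L] {B : ValuationSubring L} (hB : ∀ (σ : L ≃ₐ[M] L), ∀ x ∈ B, σ x ∈ B) {p : ℕ}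
    (hp : p.Prime) {ζ : M} (hζ : ∑ j ∈ range p, ζ ^ j = 0) {a : M}
    (ha : B.valuation (algebraMap M L a) < 1) {y : L}
    (hy : orbitProd p (algebraMap M L ζ) y = algebraMap M L a) :
    ∃ x : M, orbitProd p ζ x = a := by
  set ξ := algebraMap M L ζ with hξdef
  have hξ : ∑ j ∈ range p, ξ ^ j = 0 := by
    simp only [hξdef, ← map_pow, ← map_sum, hζ, map_zero]
  have hξ0 := ne_zero_of_geom_sum_eq_zero hp hξ
  have hξ1 := valuation_eq_one_of_geom_sum_eq_zero B hp hξ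
  obtain ⟨i, hi⟩ : ∃ i, B.valuation (y - ∑ j ∈ range i, ξ ^ j) < 1 := by
    by_contra! hcon
    rw [← hy, orbitProd, map_prod] at ha
    exact ha.not_ge (Finset.one_le_prod' fun i _ ↦ hcon i)
  obtain ⟨z, hz⟩ : ∃ z, z = (ξ ^ i)⁻¹ * (y - ∑ j ∈ range i, ξ ^ j) := ⟨_, rfl⟩
  have hzv : B.valuation z < 1 := by simpa [hz, hξ1] using hi
  have hzy : ξ ^ i * z + ∑ j ∈ range i, ξ ^ j = y := by
    rw [hz, mul_inv_cancel_left₀ (pow_ne_zero i hξ0), sub_add_cancel]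
  have hPz : orbitProd p ξ z = algebraMap M L a := by
    rw [← orbitProd_pow_mul_add hξ z i, hzy, hy]
  have hfix : ξ * z + 1 ≠ z := by
    intro h
    have h1 : (1 : L) = z - ξ * z := by linear_combination h
    have h2 := congrArg B.valuation h1
    rw [map_one] at h2
    refine (B.valuation.map_sub_lt hzv ?_).ne' h2
    rwa [map_mul, hξ1, one_mul]
  have hBv : ∀ (σ : L ≃ₐ[M] L) (x : L), B.valuation x < 1 → B.valuation (σ x) < 1 := by
    intro σ x hx
    rw [← ValuationSubring.mem_nonunits_iff, ValuationSubring.mem_nonunits_iff_or] at hx ⊢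
    refine hx.imp (fun h ↦ by rw [h, map_zero]) fun h h' ↦ h ?_
    have := hB σ.symm _ h'
    rwa [map_inv₀, AlgEquiv.symm_apply_apply] at this
  have hzfix : ∀ σ : L ≃ₐ[M] L, σ z = z := by
    intro σ
    have h3 := map_orbitProd (σ : L →+* L) p ξ z
    simp only [RingHom.coe_coe] at h3
    rw [hPz, hξdef, AlgEquiv.commutes, AlgEquiv.commutes, ← hPz, ← hξdef] at h3
    obtain ⟨j, hjp, hj⟩ := exists_eq_of_orbitProd_eq hp hξ hfix h3.symm
    rcases Nat.eq_zero_or_pos j with rfl | hj0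
    · simpa using hj
    refine absurd (one_le_valuation_geom_sum B hp hξ hj0 hjp) (not_le.mpr ?_)
    rw [show ∑ i ∈ range j, ξ ^ i = σ z - ξ ^ j * z by rw [hj]; ring]
    refine B.valuation.map_sub_lt (hBv σ z hzv) ?_
    rwa [map_mul, map_pow, hξ1, one_pow, one_mul]
  obtain ⟨x, hx⟩ := (InfiniteGalois.mem_range_algebraMap_iff_fixed z).mpr hzfix
  refine ⟨x, (algebraMap M L).injective ?_⟩
  rw [map_orbitProd, hx, ← hξdef, hPz]

end Approximation

section CyclicExtension

open Finset

variable {E T : Type*} [Field E] [Field T] [Algebra E T] {p : ℕ} {σ : T ≃ₐ[E] T}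

theorem exists_sum_mul_pow_apply_ne_zero (hp : p.Prime) (hσ : orderOf σ = p) {a : ℕ → T}
    (ha : a 0 ≠ 0) : ∃ w, ∑ i ∈ range p, a i * (σ ^ i) w ≠ 0 := by
  by_contra! hcon
  have hinj : Function.Injective fun i : range p ↦ ((σ ^ (i : ℕ) : T ≃ₐ[E] T) : T →* T) := by
    intro i j hij
    have h : σ ^ (i : ℕ) = σ ^ (j : ℕ) := AlgEquiv.ext fun x ↦ DFunLike.congr_fun hij x
    refine Subtype.ext (pow_injOn_Iio_orderOf ?_ ?_ h)
    · exact hσ.symm ▸ mem_range.mp i.2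
    · exact hσ.symm ▸ mem_range.mp j.2
  have hli := (linearIndependent_monoidHom T T).comp _ hinj
  rw [Fintype.linearIndependent_iff] at hli
  refine ha (hli (fun i ↦ a i) ?_ ⟨0, mem_range.mpr hp.pos⟩)
  ext w
  rw [Pi.zero_apply, ← hcon w, Finset.sum_apply]
  exact sum_coe_sort (range p) fun i ↦ a i * (σ ^ i) w

/-- The common generalisation of the generators of Kummer extensions (`ζ ≠ 1`) and of
Artin-Schreier extensions (`ζ = 1`). -/
theorem exists_apply_eq_mul_add_one (hp : p.Prime) (hσ : orderOf σ = p) {ζ : E}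
    (hζ : ∑ j ∈ range p, ζ ^ j = 0) :
    ∃ y : T, σ y = algebraMap E T ζ * y + 1 ∧ σ y ≠ y := by
  set ξ := algebraMap E T ζ with hξdef
  have hσξ : σ ξ = ξ := σ.commutes ζ
  have hξ : ∑ j ∈ range p, ξ ^ j = 0 := by
    simp only [hξdef, ← map_pow, ← map_sum, hζ, map_zero]
  have hτ : ∀ i w, σ ((σ⁻¹ ^ (i + 1)) w) = (σ⁻¹ ^ i) w := fun i w ↦ by
    rw [← AlgEquiv.mul_apply, pow_succ', mul_inv_cancel_left]
  have hτp : ∀ w, (σ⁻¹ ^ p) w = w := fun w ↦ by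
    rw [← hσ, inv_pow, pow_orderOf_eq_one, inv_one, AlgEquiv.one_apply]
  -- shifting a sum over a period
  have hshift : ∀ (c : ℕ → T) (w : T), (∀ i, σ (c i) = c i) → c p = c 0 →
      σ (∑ i ∈ range p, c i * (σ⁻¹ ^ i) w) = ∑ i ∈ range p, c (i + 1) * (σ⁻¹ ^ i) w := by
    intro c w hc hcp
    have h1 := sum_range_succ (fun i ↦ c i * (σ⁻¹ ^ i) w) p
    rw [sum_range_succ', hcp, hτp, pow_zero, AlgEquiv.one_apply] at h1
    rw [← add_right_cancel h1, map_sum]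
    simp only [map_mul, hc, hτ]
  obtain ⟨w, hw⟩ := exists_sum_mul_pow_apply_ne_zero hp ((orderOf_inv σ).trans hσ)
    (a := fun _ ↦ 1) one_ne_zero
  obtain ⟨w', hw'⟩ := exists_sum_mul_pow_apply_ne_zero hp ((orderOf_inv σ).trans hσ)
    (a := fun i ↦ ξ ^ i) (by simp)
  have ht := hshift (fun _ ↦ 1) w (by simp) rfl
  have hr := hshift (fun i ↦ ξ ^ i) w' (by simp [hσξ])
    (by simpa using pow_eq_one_of_geom_sum_eq_zero hξ)
  have hs := hshift (fun i ↦ ∑ j ∈ range i, ξ ^ j) w (by simp [hσξ]) (by simpa using hξ)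
  beta_reduce at hw hw' ht hr hs
  set t := ∑ i ∈ range p, 1 * (σ⁻¹ ^ i) w with htdef
  set r := ∑ i ∈ range p, ξ ^ i * (σ⁻¹ ^ i) w' with hrdef
  set s := ∑ i ∈ range p, (∑ j ∈ range i, ξ ^ j) * (σ⁻¹ ^ i) w with hsdef
  have hr' : σ r = ξ * r := by
    rw [hr, hrdef, mul_sum]
    exact sum_congr rfl fun i _ ↦ by ring
  have hs' : σ s = ξ * s + t := by
    rw [hs, hsdef, htdef, mul_sum, ← sum_add_distrib]
    refine sum_congr rfl fun i _ ↦ ?_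
    rw [geom_sum_succ]
    ring
  have hy : σ (s / t) = ξ * (s / t) + 1 := by
    rw [map_div₀, ht, hs']
    field_simp
  by_cases hfix : σ (s / t) = s / t
  · refine ⟨s / t + r, by rw [map_add, hy, hr']; ring, ?_⟩
    rw [map_add, hfix, hr', Ne, add_right_inj, mul_eq_right₀ hw']
    intro h1
    rw [hy, h1, one_mul] at hfix
    simp at hfix
  · exact ⟨s / t, hy, hfix⟩

/-- A field with a cyclic extension of prime degree `p` has an element not of the form
`orbitProd p ζ x`. -/
theorem not_surjective_orbitProd_of_isGalois [FiniteDimensional E T] [IsGalois E T]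
    (hp : p.Prime) (hcard : Nat.card (T ≃ₐ[E] T) = p) {ζ : E}
    (hζ : ∑ j ∈ range p, ζ ^ j = 0) : ¬ ∀ a : E, ∃ x : E, orbitProd p ζ x = a := by
  intro hsurj
  have : Fact p.Prime := ⟨hp⟩
  have : IsCyclic (T ≃ₐ[E] T) := isCyclic_of_prime_card hcard
  obtain ⟨σ, hσ⟩ := IsCyclic.exists_generator (α := T ≃ₐ[E] T)
  have hord : orderOf σ = p := hcard ▸ orderOf_eq_card_of_forall_mem_zpowers hσ
  obtain ⟨y, hy, hfix⟩ := exists_apply_eq_mul_add_one hp hord hζ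
  set ξ := algebraMap E T ζ with hξdef
  have hξ : ∑ j ∈ range p, ξ ^ j = 0 := by
    simp only [hξdef, ← map_pow, ← map_sum, hζ, map_zero]
  have hPσ : σ (orbitProd p ξ y) = orbitProd p ξ y := by
    have h := map_orbitProd (σ : T →+* T) p ξ y
    rw [RingHom.coe_coe, hξdef, σ.commutes, hy, orbitProd_mul_add_one hξ] at h
    exact h
  obtain ⟨a, ha⟩ : orbitProd p ξ y ∈ Set.range (algebraMap E T) := by
    rw [IsGalois.mem_range_algebraMap_iff_fixed]
    intro τ
    have hle : Subgroup.zpowers σ ≤ MulAction.stabilizer (T ≃ₐ[E] T) (orbitProd p ξ y) :=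
      Subgroup.zpowers_le.mpr hPσ
    exact hle (hσ τ)
  obtain ⟨x, rfl⟩ := hsurj a
  have hx := map_orbitProd (algebraMap E T) p ζ x
  rw [ha] at hx
  obtain ⟨i, -, hi⟩ := exists_eq_of_orbitProd_eq hp hξ (hy ▸ hfix) hx.symm
  have h := congrArg σ hi
  simp only [map_add, map_mul, map_pow, map_sum, hξdef, σ.commutes] at h
  rw [← hξdef, hi, add_left_inj] at h
  exact hfix (mul_left_cancel₀ (pow_ne_zero i (ne_zero_of_geom_sum_eq_zero hp hξ)) h).symm

end CyclicExtension

section PrimeDegree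

open Finset IntermediateField

theorem IntermediateField.exists_isGalois_finrank_prime {k Ω : Type*} [Field k] [Field Ω]
    [Algebra k Ω] (L : IntermediateField k Ω) [FiniteDimensional k L] [IsGalois k L]
    (hs : Group.IsSolvable (L ≃ₐ[k] L)) (hL : L ≠ ⊥) :
    ∃ N : IntermediateField k L, IsGalois k N ∧ (Module.finrank k N).Prime := by
  have hnt : Nontrivial (L ≃ₐ[k] L) := by
    rw [← Finite.one_lt_card_iff_nontrivial, IsGalois.card_aut_eq_finrank]
    have h1 : Module.finrank k L ≠ 1 := fun h ↦ hL (finrank_eq_one_iff.mp h)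
    have := Module.finrank_pos (R := k) (M := L)
    omega
  obtain ⟨H, hH, hle⟩ := (eq_top_or_exists_le_coatom (commutator (L ≃ₐ[k] L))).resolve_left
    (Group.IsSolvable.commutator_lt_top_of_nontrivial (L ≃ₐ[k] L)).ne
  have hn : H.Normal := Subgroup.Normal.of_commutator_le _ hle
  refine ⟨fixedField H, inferInstance, ?_⟩
  rw [finrank_eq_fixingSubgroup_index, fixingSubgroup_fixedField, Subgroup.index]
  have hcomm := Subgroup.Normal.quotient_commutative_iff_commutator_le.mpr hle
  have hnt' : Nontrivial ((L ≃ₐ[k] L) ⧸ H) := QuotientGroup.nontrivial_iff.mpr hH.1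
  obtain ⟨p, hp, hpd⟩ := Nat.exists_prime_and_dvd (Finite.one_lt_card_iff_nontrivial.mpr hnt').ne'
  have : Fact p.Prime := ⟨hp⟩
  obtain ⟨q, hq⟩ := exists_prime_orderOf_dvd_card' p hpd
  have htop : (Subgroup.zpowers q).comap (QuotientGroup.mk' H) = ⊤ := by
    refine hH.2 _ (lt_of_le_of_ne ?_ ?_)
    · exact (QuotientGroup.ker_mk' H).symm.trans_le ((QuotientGroup.mk' H).ker_le_comap _)
    · intro h
      have h1 : Subgroup.zpowers q = ⊥ := by
        rw [← Subgroup.map_comap_eq_self_of_surjective (QuotientGroup.mk'_surjective H)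
          (Subgroup.zpowers q), ← h, QuotientGroup.map_mk'_self]
      rw [Subgroup.zpowers_eq_bot] at h1
      rw [h1, orderOf_one] at hq
      exact hp.one_lt.ne hq
  rw [← Subgroup.comap_top (QuotientGroup.mk' H)] at htop
  rw [← Subgroup.card_top, ← Subgroup.comap_injective (QuotientGroup.mk'_surjective H) htop,
    Nat.card_zpowers, hq]
  exact hp

theorem finiteDimensional_of_sup_eq_top {k T : Type*} [Field k] [Field T] [Algebra k T]
    {N E : IntermediateField k T} [FiniteDimensional k N] (hsup : N ⊔ E = ⊤) :
    FiniteDimensional E T := by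
  have hN : N.FG := essFiniteType_iff.mp inferInstance
  obtain ⟨t, ht, rfl⟩ := fg_def.mp hN
  have := ht.to_subtype
  have : FiniteDimensional E (adjoin E t) := finiteDimensional_adjoin fun x hx ↦ by
    have hx' : IsIntegral k (⟨x, subset_adjoin k t hx⟩ : adjoin k t) := .of_finite k _
    exact (hx'.map (adjoin k t).val).tower_top
  have htop : adjoin E t = ⊤ := by
    rw [← restrictScalars_eq_top_iff (K := k), restrictScalars_adjoin, adjoin_union, adjoin_self,
      sup_comm, hsup]
  rw [htop] at this
  exact topEquiv.toLinearEquiv.finiteDimensional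

theorem natCard_aut_eq_of_sup_eq_top {k T : Type*} [Field k] [Field T] [Algebra k T]
    {N E : IntermediateField k T} [FiniteDimensional k N] [IsGalois k N]
    (hp : (Module.finrank k N).Prime)
    (hE : ∀ x ∈ E, ∃ f : Polynomial k, f ≠ 0 ∧ f.natDegree < Module.finrank k N ∧
      Polynomial.aeval x f = 0) (hsup : N ⊔ E = ⊤) :
    Nat.card (T ≃ₐ[E] T) = Module.finrank k N := by
  have := IsGalois.sup_right N E hsup
  have := finiteDimensional_of_sup_eq_top hsup
  have hd := Subgroup.card_dvd_of_injective _
    (restrictRestrictAlgEquivMapHom_injective N E hsup)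
  rw [IsGalois.card_aut_eq_finrank k N, Nat.dvd_prime hp] at hd
  refine hd.resolve_left fun h1 ↦ ?_
  rw [IsGalois.card_aut_eq_finrank] at h1
  obtain ⟨θ, hθ⟩ := Field.exists_primitive_element k N
  have hdeg := (Field.primitive_element_iff_minpoly_natDegree_eq k θ).mp hθ
  obtain ⟨x, hx⟩ := (Algebra.finrank_eq_one_iff_bijective_algebraMap.mp h1).2 θ
  obtain ⟨f, hf0, hf, hfx⟩ := hE θ (hx ▸ x.2)
  have hle := Polynomial.natDegree_le_natDegree (minpoly.degree_le_of_ne_zero k (θ : T) hf0 hfx)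
  rw [← minpoly_eq, hdeg] at hle
  omega

theorem not_surjective_orbitProd_of_finrank_eq {k k' N : Type*} [Field k] [Field k'] [Field N]
    [Algebra k k'] [Algebra k N] {p : ℕ} (hp : p.Prime)
    (hdeg : ∀ x : k', ∃ f : Polynomial k, f ≠ 0 ∧ f.natDegree < p ∧ Polynomial.aeval x f = 0)
    [FiniteDimensional k N] [IsGalois k N] (hN : Module.finrank k N = p) {ζ : k'}
    (hζ : ∑ j ∈ range p, ζ ^ j = 0) : ¬ ∀ a : k', ∃ x : k', orbitProd p ζ x = a := by
  intro hsurj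
  let Ω := AlgebraicClosure k'
  have : Algebra.IsAlgebraic k k' := ⟨fun x ↦ by
    obtain ⟨f, hf, -, hfx⟩ := hdeg x
    exact ⟨f, hf, hfx⟩⟩
  let φ : N →ₐ[k] Ω := IsAlgClosed.lift
  let ψ : k' →ₐ[k] Ω := IsScalarTower.toAlgHom k k' Ω
  let N₀ := φ.fieldRange
  let E₀ := ψ.fieldRange
  let T := N₀ ⊔ E₀
  let N₁ : IntermediateField k T := restrict (le_sup_left : N₀ ≤ T)
  let E₁ : IntermediateField k T := restrict (le_sup_right : E₀ ≤ T)
  have hsup : N₁ ⊔ E₁ = ⊤ := by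
    rw [← lift_inj, lift_top, lift_sup, lift_restrict, lift_restrict]
  let eN : N ≃ₐ[k] N₁ := (AlgHom.equivFieldRange φ).trans (restrictAlgEquiv le_sup_left)
  let eE : k' ≃ₐ[k] E₁ := (AlgHom.equivFieldRange ψ).trans (restrictAlgEquiv le_sup_right)
  have : FiniteDimensional k N₁ := eN.toLinearEquiv.finiteDimensional
  have : IsGalois k N₁ := IsGalois.of_algEquiv eN
  have hN₁ : Module.finrank k N₁ = p := by rw [← hN, eN.toLinearEquiv.finrank_eq]
  have : IsGalois E₁ T := IsGalois.sup_right N₁ E₁ hsup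
  have : FiniteDimensional E₁ T := finiteDimensional_of_sup_eq_top hsup
  refine not_surjective_orbitProd_of_isGalois hp ?_ (ζ := eE ζ) ?_ ?_ (T := T) (E := E₁)
  · rw [← hN₁]
    refine natCard_aut_eq_of_sup_eq_top (hN₁ ▸ hp) (fun x hx ↦ ?_) hsup
    obtain ⟨f, hf0, hf, hfx⟩ := hdeg (eE.symm ⟨x, hx⟩)
    refine ⟨f, hf0, hN₁ ▸ hf, ?_⟩
    have h := Polynomial.aeval_algHom_apply (E₁.val.comp (eE : k' →ₐ[k] E₁)) (eE.symm ⟨x, hx⟩) f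
    rw [hfx, map_zero] at h
    simpa using h
  · simp only [← map_pow, ← map_sum, hζ, map_zero]
  · intro a
    obtain ⟨x, hx⟩ := hsurj (eE.symm a)
    refine ⟨eE x, ?_⟩
    have := map_orbitProd (eE : k' →+* E₁) p ζ x
    rw [hx] at this
    simpa using this.symm

end PrimeDegree

section Comparability

open Finset IntermediateField

theorem exists_isGalois_finrank_prime_of_not_isSolvClosed {k : Type*} [Field k]
    (h : ¬ IsSolvClosed k) :
    ∃ (L : IntermediateField k (AlgebraicClosure k)) (N : IntermediateField k L),
      FiniteDimensional k N ∧ IsGalois k N ∧ (Module.finrank k N).Prime := by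
  simp only [IsSolvClosed, not_forall] at h
  obtain ⟨L, _, _, hs, hL⟩ := h
  obtain ⟨N, hN, hp⟩ := L.exists_isGalois_finrank_prime hs hL
  exact ⟨L, N, inferInstance, hN, hp⟩

theorem exists_geom_sum_eq_zero {Ω : Type*} [Field Ω] [IsAlgClosed Ω] {p : ℕ} (hp : p.Prime) :
    ∃ ζ : Ω, ∑ j ∈ range p, ζ ^ j = 0 := by
  have : Fact p.Prime := ⟨hp⟩
  obtain ⟨ζ, hζ⟩ := IsAlgClosed.exists_root (Polynomial.cyclotomic p Ω) (by
    rw [Polynomial.degree_cyclotomic]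
    exact_mod_cast (Nat.totient_pos.mpr hp.pos).ne')
  rw [Polynomial.cyclotomic_prime, Polynomial.IsRoot.def] at hζ
  exact ⟨ζ, by simpa [Polynomial.eval_finsetSum] using hζ⟩

theorem finrank_adjoin_lt_of_geom_sum_eq_zero {K L : Type*} [Field K] [Field L] [Algebra K L]
    {p : ℕ} (hp : p.Prime) {ζ : L} (hζ : ∑ j ∈ range p, ζ ^ j = 0) :
    FiniteDimensional K K⟮ζ⟯ ∧ Module.finrank K K⟮ζ⟯ < p := by
  have : Fact p.Prime := ⟨hp⟩
  have h0 : Polynomial.aeval ζ (Polynomial.cyclotomic p K) = 0 := by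
    simpa [Polynomial.cyclotomic_prime] using hζ
  have hint : IsIntegral K ζ := ⟨_, Polynomial.cyclotomic.monic p K, h0⟩
  refine ⟨adjoin.finiteDimensional hint, ?_⟩
  rw [adjoin.finrank hint]
  refine (Polynomial.natDegree_le_natDegree
    (minpoly.min K ζ (Polynomial.cyclotomic.monic p K) h0)).trans_lt ?_
  rw [Polynomial.natDegree_cyclotomic]
  exact Nat.totient_lt p hp.one_lt

theorem exists_orbitProd_eq {Ω : Type*} [Field Ω] [IsAlgClosed Ω] {p : ℕ} (hp : p ≠ 0)
    (ζ a : Ω) : ∃ y, orbitProd p ζ y = a := by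
  let P : Polynomial Ω := orbitProd p (Polynomial.C ζ) Polynomial.X
  have hP : P = ∏ i ∈ range p, (Polynomial.X - Polynomial.C (∑ j ∈ range i, ζ ^ j)) := by
    simp [P, orbitProd]
  have hdeg : P.natDegree = p := by
    rw [hP, Polynomial.natDegree_prod_of_monic _ _ fun i _ ↦ Polynomial.monic_X_sub_C _]
    simp only [Polynomial.natDegree_X_sub_C, sum_const, card_range, smul_eq_mul, mul_one]
  obtain ⟨y, hy⟩ := IsAlgClosed.exists_root (P - Polynomial.C a) (by
    intro h
    have := Polynomial.natDegree_eq_of_degree_eq_some h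
    rw [Polynomial.natDegree_sub_C, hdeg] at this
    exact hp this)
  refine ⟨y, ?_⟩
  have h := map_orbitProd (Polynomial.evalRingHom y) p (Polynomial.C ζ) Polynomial.X
  simp only [Polynomial.coe_evalRingHom, Polynomial.eval_C, Polynomial.eval_X] at h
  rw [← h, ← sub_eq_zero]
  simpa using hy

theorem mem_of_orbitProd_mem {M : Type*} [Field M] {A : ValuationSubring M} {p : ℕ} (hp : p ≠ 0)
    {ζ x : M} (hζ : ζ ∈ A) (hx : orbitProd p ζ x ∈ A) : x ∈ A := by
  by_contra hxA
  have h1 : ∀ i ∈ range p, 1 < A.valuation (x - ∑ j ∈ range i, ζ ^ j) := by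
    intro i _
    rw [← not_le, A.valuation_le_one_iff]
    intro hi
    refine hxA ?_
    have := A.add_mem _ _ hi (sum_mem fun j (_ : j ∈ range i) ↦ pow_mem hζ j)
    rwa [sub_add_cancel] at this
  rw [← A.valuation_le_one_iff, orbitProd, map_prod] at hx
  have h0 := mem_range.mpr (Nat.pos_of_ne_zero hp)
  exact ((h1 0 h0).trans_le (single_le_prod' (fun i hi ↦ (h1 i hi).le) h0)).not_ge hx

/-- Residue field extensions of a finite extension have bounded degree. -/
theorem exists_aeval_residue_eq_zero {K M : Type*} [Field K] [Field M] [Algebra K M]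
    [FiniteDimensional K M] {O : ValuationSubring K} {A : ValuationSubring M}
    (hA : ∀ x ∈ A, IsIntegral O x) [Algebra O A] [IsScalarTower O A M]
    [Algebra (IsLocalRing.ResidueField O) (IsLocalRing.ResidueField A)]
    [IsScalarTower O (IsLocalRing.ResidueField O) (IsLocalRing.ResidueField A)]
    (x : IsLocalRing.ResidueField A) :
    ∃ f : Polynomial (IsLocalRing.ResidueField O), f ≠ 0 ∧
      f.natDegree ≤ Module.finrank K M ∧ Polynomial.aeval x f = 0 := by
  obtain ⟨x, rfl⟩ := IsLocalRing.residue_surjective x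
  have hx := hA x x.2
  have hmon := minpoly.monic hx
  refine ⟨(minpoly O (x : M)).map (algebraMap O (IsLocalRing.ResidueField O)),
    (hmon.map _).ne_zero, ?_, ?_⟩
  · rw [hmon.natDegree_map]
    have := minpoly.isIntegrallyClosed_eq_field_fractions K M hx
    rw [Algebra.algebraMap_self_apply] at this
    rw [← hmon.natDegree_map (algebraMap O K), ← this]
    exact minpoly.natDegree_le _
  · rw [Polynomial.aeval_map_algebraMap]
    have h0 : Polynomial.aeval x (minpoly O (x : M)) = 0 := by
      refine Subtype.ext ?_
      have := Polynomial.aeval_algebraMap_apply M x (minpoly O (x : M))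
      exact this.symm.trans (minpoly.aeval O (x : M))
    have := Polynomial.aeval_algebraMap_apply (IsLocalRing.ResidueField A) x (minpoly O (x : M))
    rw [h0, map_zero] at this
    exact this

theorem le_or_le_of_existsUnique_comap_eq {K M L : Type*} [Field K] [Field M] [Field L]
    [Algebra K M] [Algebra M L] [Algebra K L] [IsScalarTower K M L] [FiniteDimensional K M]
    [IsGalois K L] {O₁ O₂ : ValuationSubring K}
    (h₁ : ∃! C : ValuationSubring L, C.comap (algebraMap K L) = O₁)
    (h₂ : ∃! C : ValuationSubring L, C.comap (algebraMap K L) = O₂)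
    {N : Type*} [Field N] [Algebra (IsLocalRing.ResidueField O₁) N]
    [FiniteDimensional (IsLocalRing.ResidueField O₁) N]
    [IsGalois (IsLocalRing.ResidueField O₁) N]
    {p : ℕ} (hp : p.Prime) (hpN : Module.finrank (IsLocalRing.ResidueField O₁) N = p)
    (hM : Module.finrank K M < p) {ζ : M} (hζ : ∑ j ∈ range p, ζ ^ j = 0)
    (hL : ∀ a : M, ∃ y : L, orbitProd p (algebraMap M L ζ) y = algebraMap M L a) :
    O₁ ≤ O₂ ∨ O₂ ≤ O₁ := by
  by_contra! hcon
  rw [existsUnique_comap_eq_iff] at h₁ h₂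
  have : IsGalois M L := IsGalois.tower_top_of_isGalois K M L
  have : IsScalarTower O₁ M L := .of_algebraMap_eq fun x ↦ IsScalarTower.algebraMap_apply K M L x
  have : IsScalarTower O₂ M L := .of_algebraMap_eq fun x ↦ IsScalarTower.algebraMap_apply K M L x
  obtain ⟨B₂, hB₂⟩ : ∃ B : ValuationSubring L, ∀ x, x ∈ B ↔ IsIntegral O₂ x :=
    ⟨integralClosureValuationSubring h₂, fun x ↦ Iff.rfl⟩
  obtain ⟨A₁, hA₁⟩ : ∃ A : ValuationSubring M, ∀ x, x ∈ A ↔ IsIntegral O₁ x :=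
    ⟨(integralClosureValuationSubring h₁).comap (algebraMap M L), fun x ↦
      isIntegral_algebraMap_iff (algebraMap M L).injective⟩
  obtain ⟨A₂, hA₂⟩ : ∃ A : ValuationSubring M, A = B₂.comap (algebraMap M L) := ⟨_, rfl⟩
  have hA₂' : ∀ x, x ∈ A₂ ↔ IsIntegral O₂ x := fun x ↦ by
    rw [hA₂, ValuationSubring.mem_comap, hB₂]
    exact isIntegral_algebraMap_iff (algebraMap M L).injective
  have hO₁ : ∀ x, algebraMap K M x ∈ A₁ ↔ x ∈ O₁ := fun x ↦
    (hA₁ _).trans isIntegral_algebraMap_iff_mem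
  have hO₂ : ∀ x, algebraMap K M x ∈ A₂ ↔ x ∈ O₂ := fun x ↦
    (hA₂' _).trans isIntegral_algebraMap_iff_mem
  have h₁₂ : ¬ A₁ ≤ A₂ := fun hle ↦ hcon.1 fun x hx ↦ (hO₂ x).mp (hle ((hO₁ x).mpr hx))
  have h₂₁ : ¬ A₂ ≤ A₁ := fun hle ↦ hcon.2 fun x hx ↦ (hO₁ x).mp (hle ((hO₂ x).mpr hx))
  have hζA : ζ ∈ A₁ :=
    (A₁.valuation_le_one_iff ζ).mp (valuation_eq_one_of_geom_sum_eq_zero A₁ hp hζ).le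
  -- the residue field of `A₁` is closed under roots of `orbitProd`
  have hsurj : ∀ a : IsLocalRing.ResidueField A₁, ∃ x,
      orbitProd p (IsLocalRing.residue A₁ ⟨ζ, hζA⟩) x = a := by
    intro a
    obtain ⟨u, rfl⟩ := IsLocalRing.residue_surjective a
    obtain ⟨b, hb₁, hb₂⟩ := exists_valuation_sub_lt_one h₁₂ h₂₁ u.2
    obtain ⟨y, hy⟩ := hL b
    have hbB : B₂.valuation (algebraMap M L b) < 1 := by
      rw [← ValuationSubring.mem_nonunits_iff, ValuationSubring.mem_nonunits_iff_or] at hb₂ ⊢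
      rwa [map_eq_zero, ← map_inv₀, ← ValuationSubring.mem_comap, ← hA₂]
    have hinv : ∀ (σ : L ≃ₐ[M] L), ∀ x ∈ B₂, σ x ∈ B₂ := fun σ x hx ↦
      (hB₂ _).mpr (isIntegral_conj ((hB₂ x).mp hx) (σ.restrictScalars K))
    obtain ⟨x, hx⟩ := exists_orbitProd_eq_of_invariant hinv hp hζ hbB hy
    have hbA : b ∈ A₁ := by
      have := A₁.add_mem _ _ ((A₁.valuation_le_one_iff _).mp hb₁.le) u.2
      rwa [sub_add_cancel] at this
    have hxA : x ∈ A₁ := mem_of_orbitProd_mem hp.ne_zero hζA (hx ▸ hbA)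
    refine ⟨IsLocalRing.residue A₁ ⟨x, hxA⟩, ?_⟩
    rw [← map_orbitProd, ← sub_eq_zero, ← map_sub, IsLocalRing.residue_eq_zero_iff,
      ValuationSubring.valuation_lt_one_iff]
    have := map_orbitProd A₁.subtype p ⟨ζ, hζA⟩ ⟨x, hxA⟩
    rw [ValuationSubring.subtype_apply] at this
    rw [AddSubgroupClass.coe_sub, this]
    exact hx ▸ hb₁
  let f : O₁ →+* A₁ :=
    ((algebraMap K M).comp O₁.subtype).codRestrict A₁ fun x ↦ (hO₁ x).mpr x.2
  have hf : IsLocalHom f := ⟨fun x hx ↦ by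
    have hfx : (f x : M) = algebraMap K M x := rfl
    rw [← not_not (a := IsUnit x), ← mem_nonunits_iff, ← IsLocalRing.mem_maximalIdeal,
      ← ValuationSubring.coe_mem_nonunits_iff, ValuationSubring.mem_nonunits_iff_or, ← hO₁,
      map_inv₀, ← map_eq_zero (algebraMap K M), ← hfx, ← ValuationSubring.mem_nonunits_iff_or,
      ValuationSubring.coe_mem_nonunits_iff, IsLocalRing.mem_maximalIdeal, mem_nonunits_iff,
      not_not]
    exact hx⟩
  let _ : Algebra O₁ A₁ := f.toAlgebra
  have : IsScalarTower O₁ A₁ M := .of_algebraMap_eq fun _ ↦ rfl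
  let _ : Algebra (IsLocalRing.ResidueField O₁) (IsLocalRing.ResidueField A₁) :=
    (IsLocalRing.ResidueField.map f).toAlgebra
  have : IsScalarTower O₁ (IsLocalRing.ResidueField O₁) (IsLocalRing.ResidueField A₁) :=
    .of_algebraMap_eq fun _ ↦ rfl
  refine not_surjective_orbitProd_of_finrank_eq hp (fun x ↦ ?_) hpN ?_ hsurj
  · obtain ⟨g, hg0, hg, hgx⟩ := exists_aeval_residue_eq_zero (fun x hx ↦ (hA₁ x).mp hx) x
    exact ⟨g, hg0, hg.trans_lt hM, hgx⟩
  · have hζ' : ∑ j ∈ range p, (⟨ζ, hζA⟩ : A₁) ^ j = 0 := Subtype.ext (by simpa using hζ)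
    simp only [← map_pow, ← map_sum, hζ', map_zero]

theorem IsSolvHenselian.le_or_le {K : Type*} [Field K] {O₁ O₂ : ValuationSubring K}
    (h₁ : IsSolvHenselian O₁) (h₂ : IsSolvHenselian O₂)
    (hn : ¬ IsSolvClosed (IsLocalRing.ResidueField O₁)) : O₁ ≤ O₂ ∨ O₂ ≤ O₁ := by
  obtain ⟨_, N, _, _, hp⟩ := exists_isGalois_finrank_prime_of_not_isSolvClosed hn
  obtain ⟨p, hpN⟩ : ∃ p, Module.finrank (IsLocalRing.ResidueField O₁) N = p := ⟨_, rfl⟩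
  rw [hpN] at hp
  obtain ⟨ζ, hζ⟩ := exists_geom_sum_eq_zero (Ω := AlgebraicClosure K) hp
  obtain ⟨ζL, rfl⟩ : ∃ ζL : solvClosure K, (ζL : AlgebraicClosure K) = ζ :=
    ⟨⟨ζ, geom_sum_root_mem hp hζ⟩, rfl⟩
  have hζL : ∑ j ∈ range p, ζL ^ j = 0 := Subtype.ext (by simpa using hζ)
  obtain ⟨hfin, hlt⟩ := finrank_adjoin_lt_of_geom_sum_eq_zero (K := K) hp hζL
  refine le_or_le_of_existsUnique_comap_eq h₁ h₂ hp hpN hlt (ζ := AdjoinSimple.gen K ζL)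
    (Subtype.ext (by simpa using hζL)) fun a ↦ ?_
  obtain ⟨y, hy⟩ := exists_orbitProd_eq hp.ne_zero (ζL : AlgebraicClosure K)
    ((a : solvClosure K) : AlgebraicClosure K)
  have hyL : y ∈ solvClosure K := orbitProd_root_mem hp hζ (hy ▸ (a : solvClosure K).2)
  refine ⟨⟨y, hyL⟩, Subtype.ext ?_⟩
  refine (map_orbitProd (algebraMap (solvClosure K) (AlgebraicClosure K)) p _ _).trans ?_
  rw [AdjoinSimple.algebraMap_gen]
  exact hy

end Comparability

/-- The intersection of a chain of valuation rings. -/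
def ValuationSubring.sInfOfChain {K : Type*} [Field K] (S : Set (ValuationSubring K))
    (hS : IsChain (· ≤ ·) S) : ValuationSubring K :=
  { sInf (ValuationSubring.toSubring '' S) with
    mem_or_inv_mem' := fun x ↦ by
      simp only [Subsemiring.coe_carrier_toSubmonoid, Subring.coe_toSubsemiring]
      by_contra! hcon
      simp only [SetLike.mem_coe, Subring.mem_sInf, Set.forall_mem_image, not_forall] at hcon
      obtain ⟨⟨O, hO, hx⟩, O', hO', hx'⟩ := hcon
      rcases hS.total hO hO' with h | h
      · exact hx' (h ((O.mem_or_inv_mem x).resolve_left hx))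
      · exact hx (h ((O'.mem_or_inv_mem x).resolve_right hx')) }

theorem ValuationSubring.mem_sInfOfChain {K : Type*} [Field K] {S : Set (ValuationSubring K)}
    {hS : IsChain (· ≤ ·) S} {x : K} : x ∈ sInfOfChain S hS ↔ ∀ O ∈ S, x ∈ O := by
  change x ∈ sInf (ValuationSubring.toSubring '' S) ↔ _
  simp [Subring.mem_sInf]

theorem isSolvHenselian_sInfOfChain {K : Type*} [Field K] {S : Set (ValuationSubring K)}
    (hS : IsChain (· ≤ ·) S) (h : ∀ O ∈ S, IsSolvHenselian O) :
    IsSolvHenselian (ValuationSubring.sInfOfChain S hS) := by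
  unfold IsSolvHenselian at h ⊢
  simp only [existsUnique_comap_eq_iff] at h ⊢
  simp only [isIntegral_iff_coeff_minpoly_mem] at h ⊢
  simp only [ValuationSubring.mem_sInfOfChain]
  intro x
  by_contra! hcon
  obtain ⟨⟨i, O, hO, hx⟩, j, O', hO', hx'⟩ := hcon
  rcases hS.total hO hO' with hle | hle
  · exact hx' (hle (((h O hO x).resolve_left fun hi ↦ hx (hi i)) j))
  · exact hx (hle (((h O' hO' x).resolve_right fun hi ↦ hx' (hi j)) i))

/-- If some solv-henselian valuation ring of `K` has non-solv-closed
residue field, then the intersection of all such valuation rings is itself a solv-henselian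
valuation ring of `K`. -/
theorem statement_14 (K : Type) [Field K]
    (h : ∃ O : ValuationSubring K, IsSolvHenselian O ∧
      ¬ IsSolvClosed (IsLocalRing.ResidueField ↥O)) :
    ∃ Ostar : ValuationSubring K, IsSolvHenselian Ostar ∧
      (Ostar : Set K) =
        ⋂ O ∈ {O : ValuationSubring K | IsSolvHenselian O ∧
          ¬ IsSolvClosed (IsLocalRing.ResidueField ↥O)}, (O : Set K) := by
  have hS : IsChain (· ≤ ·) {O : ValuationSubring K | IsSolvHenselian O ∧
      ¬ IsSolvClosed (IsLocalRing.ResidueField ↥O)} :=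
    fun O₁ h₁ O₂ h₂ _ ↦ h₁.1.le_or_le h₂.1 h₁.2
  refine ⟨.sInfOfChain _ hS, isSolvHenselian_sInfOfChain hS fun O hO ↦ hO.1, ?_⟩
  ext x
  simp only [SetLike.mem_coe, ValuationSubring.mem_sInfOfChain, Set.mem_iInter]
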